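/- Let G = (V,E) be a finite simple graph on n ≥ 7 vertices, and let (X_1, X_2) be a balanced partition of V (i.e., ||X_1| − |X_2|| ≤ 1) that minimizes the cut size E(X_1, X_2) among all balanced partitions. Then for every set S ⊆ V with |S| ≥ ⌊n/2⌋, max{E(X_1 ∩ S, X_1), E(X_2 ∩ S, X_2)} ≥ ((n−6)/(n−2))·E(X_1 ∩ S, X_2 ∩ S). -/

import Mathlib

open Finset

/-- Number of neighbors of `i` inside the set `S`. -/
def nbrCount {V : Type*} [Fintype V] [DecidableEq V] (G : SimpleGraph V)
    [DecidableRel G.Adj] (i : V) (S : Finset V) : ℕ :=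
  (G.neighborFinset i ∩ S).card

/-- Number of edges (counted from `A`) between the sets `A` and `B`. -/
def cutCount {V : Type*} [Fintype V] [DecidableEq V] (G : SimpleGraph V)
    [DecidableRel G.Adj] (A B : Finset V) : ℕ :=
  ∑ i ∈ A, nbrCount G i B

section

variable {V : Type*} [Fintype V] [DecidableEq V] (G : SimpleGraph V) [DecidableRel G.Adj]

theorem nbrCount_eq_sum (i : V) (S : Finset V) :
    nbrCount G i S = ∑ j ∈ S, if G.Adj i j then 1 else 0 := by
  rw [nbrCount, Finset.sum_boole, Nat.cast_id]
  congr 1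
  ext j
  simp [and_comm]

theorem nbrCount_mono (i : V) {S T : Finset V} (h : S ⊆ T) : nbrCount G i S ≤ nbrCount G i T :=
  card_le_card (inter_subset_inter_left h)

theorem nbrCount_insert (i : V) {j : V} {S : Finset V} (hj : j ∉ S) :
    nbrCount G i (insert j S) = (if G.Adj i j then 1 else 0) + nbrCount G i S := by
  simp only [nbrCount_eq_sum, sum_insert hj]

theorem cutCount_comm (A B : Finset V) : cutCount G A B = cutCount G B A := by
  simp only [cutCount, nbrCount_eq_sum]
  rw [sum_comm]
  simp only [G.adj_comm]

theorem cutCount_mono_right (A : Finset V) {B C : Finset V} (h : B ⊆ C) :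
    cutCount G A B ≤ cutCount G A C :=
  sum_le_sum fun i _ => nbrCount_mono G i h

theorem cutCount_insert_left {i : V} {A : Finset V} (hi : i ∉ A) (B : Finset V) :
    cutCount G (insert i A) B = nbrCount G i B + cutCount G A B :=
  sum_insert hi

theorem cutCount_insert_right (A : Finset V) {j : V} {B : Finset V} (hj : j ∉ B) :
    cutCount G A (insert j B) = nbrCount G j A + cutCount G A B := by
  rw [cutCount_comm, cutCount_insert_left G hj, cutCount_comm G B]

/-- If exchanging `i ∈ X1` with `j ∈ X2` does not decrease the cut, then the neighbors of `i` and
`j` across the cut number at most those within their own parts, plus two if `i` and `j` are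
adjacent. -/
theorem nbrCount_add_le_of_cutCount_le_swap {X1 X2 : Finset V} (hdisj : Disjoint X1 X2) {i j : V}
    (hi : i ∈ X1) (hj : j ∈ X2)
    (h : cutCount G X1 X2 ≤ cutCount G (insert j (X1.erase i)) (insert i (X2.erase j))) :
    nbrCount G i X2 + nbrCount G j X1 ≤
      nbrCount G i X1 + nbrCount G j X2 + 2 * if G.Adj i j then 1 else 0 := by
  have hi2 : i ∉ X2 := disjoint_left.1 hdisj hi
  have hj1 : j ∉ X1 := disjoint_right.1 hdisj hj
  obtain ⟨A, hiA, rfl⟩ : ∃ A, i ∉ A ∧ insert i A = X1 :=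
    ⟨X1.erase i, notMem_erase i X1, insert_erase hi⟩
  obtain ⟨B, hjB, rfl⟩ : ∃ B, j ∉ B ∧ insert j B = X2 :=
    ⟨X2.erase j, notMem_erase j X2, insert_erase hj⟩
  have hjA : j ∉ A := fun h => hj1 (mem_insert_of_mem h)
  have hiB : i ∉ B := fun h => hi2 (mem_insert_of_mem h)
  rw [erase_insert hiA, erase_insert hjB] at h
  simp only [cutCount_insert_left G hiA, cutCount_insert_left G hjA,
    cutCount_insert_right G _ hiB, cutCount_insert_right G _ hjB, nbrCount_insert G _ hiA,
    nbrCount_insert G _ hjB, nbrCount_insert G _ hiB, G.loopless.irrefl, G.adj_comm j i,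
    if_false] at h ⊢
  omega

theorem sum_nbrCount_add_le {X1 X2 A B : Finset V}
    (h : ∀ i ∈ A, ∀ j ∈ B, nbrCount G i X2 + nbrCount G j X1 ≤
      nbrCount G i X1 + nbrCount G j X2 + 2 * if G.Adj i j then 1 else 0) :
    #B * cutCount G A X2 + #A * cutCount G B X1 ≤
      #B * cutCount G A X1 + #A * cutCount G B X2 + 2 * cutCount G A B := by
  have key := sum_le_sum fun i hi => sum_le_sum (h i hi)
  simp only [sum_add_distrib, sum_const, smul_eq_mul, ← mul_sum, ← nbrCount_eq_sum] at key
  exact key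

end

theorem stmt_7 {V : Type*} [Fintype V] [DecidableEq V] (G : SimpleGraph V)
    [DecidableRel G.Adj] (n : ℕ) (hn : n = Fintype.card V) (hn7 : 7 ≤ n)
    (X1 X2 : Finset V) (hdisj : Disjoint X1 X2) (hcover : X1 ∪ X2 = univ)
    (hbal : (X1.card : ℤ) - X2.card ≤ 1 ∧ (X2.card : ℤ) - X1.card ≤ 1)
    (hmin : ∀ Y1 Y2 : Finset V, Disjoint Y1 Y2 → Y1 ∪ Y2 = univ →
      ((Y1.card : ℤ) - Y2.card ≤ 1 ∧ (Y2.card : ℤ) - Y1.card ≤ 1) →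
      cutCount G X1 X2 ≤ cutCount G Y1 Y2) :
    ∀ S : Finset V, n / 2 ≤ S.card →
      (max (cutCount G (X1 ∩ S) X1) (cutCount G (X2 ∩ S) X2) : ℝ) ≥
        (((n : ℝ) - 6) / ((n : ℝ) - 2)) * cutCount G (X1 ∩ S) (X2 ∩ S) := by
  intro S hS
  have hswap : ∀ i ∈ X1 ∩ S, ∀ j ∈ X2 ∩ S, nbrCount G i X2 + nbrCount G j X1 ≤
      nbrCount G i X1 + nbrCount G j X2 + 2 * if G.Adj i j then 1 else 0 := by
    intro i hi j hj
    have hi1 := (mem_inter.1 hi).1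
    have hj2 := (mem_inter.1 hj).1
    have hi2 : i ∉ X2 := disjoint_left.1 hdisj hi1
    have hj1 : j ∉ X1 := disjoint_right.1 hdisj hj2
    refine nbrCount_add_le_of_cutCount_le_swap G hdisj hi1 hj2 (hmin _ _ ?_ ?_ ?_)
    · rw [disjoint_left] at hdisj ⊢
      intro x
      simp only [mem_insert, mem_erase]
      have := @hdisj x
      grind
    · ext x
      have hx : x ∈ X1 ∪ X2 := hcover ▸ mem_univ x
      simp only [mem_union, mem_insert, mem_erase, mem_univ, iff_true] at hx ⊢
      tauto
    · rwa [card_insert_of_notMem (fun h => hj1 (mem_of_mem_erase h)), card_erase_add_one hi1,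
        card_insert_of_notMem (fun h => hi2 (mem_of_mem_erase h)), card_erase_add_one hj2]
  have hsum := sum_nbrCount_add_le G hswap
  have hA := cutCount_mono_right G (X1 ∩ S) (inter_subset_left : X2 ∩ S ⊆ X2)
  have hB := cutCount_mono_right G (X2 ∩ S) (inter_subset_left : X1 ∩ S ⊆ X1)
  rw [cutCount_comm G (X2 ∩ S) (X1 ∩ S)] at hB
  have hcard : #(X1 ∩ S) + #(X2 ∩ S) = #S := by
    rw [← card_union_of_disjoint (hdisj.mono inter_subset_left inter_subset_left),
      ← union_inter_distrib_right, hcover, univ_inter]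
  have hcard' : n ≤ 2 * (#(X1 ∩ S) + #(X2 ∩ S)) + 2 := by omega
  generalize #(X1 ∩ S) = a at *
  generalize #(X2 ∩ S) = b at *
  generalize cutCount G (X1 ∩ S) (X2 ∩ S) = e at *
  have hle := (add_le_add (Nat.mul_le_mul_left b hA) (Nat.mul_le_mul_left a hB)).trans hsum
  generalize cutCount G (X1 ∩ S) X1 = p at *
  generalize cutCount G (X2 ∩ S) X2 = q at *
  have hp := le_max_left (p : ℝ) q
  have hq := le_max_right (p : ℝ) q
  generalize max (p : ℝ) q = M at *
  have hle' : (b * e + a * e : ℝ) ≤ b * p + a * q + 2 * e := mod_cast hle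
  have hn' : (7 : ℝ) ≤ n := mod_cast hn7
  have hab : (n : ℝ) ≤ 2 * (a + b) + 2 := mod_cast hcard'
  have he : (0 : ℝ) ≤ e := e.cast_nonneg
  have hM : ((a : ℝ) + b) * (e - M) ≤ 2 * e := by
    have h1 := mul_le_mul_of_nonneg_left hp (b.cast_nonneg : (0 : ℝ) ≤ b)
    have h2 := mul_le_mul_of_nonneg_left hq (a.cast_nonneg : (0 : ℝ) ≤ a)
    linarith
  rw [ge_iff_le, div_mul_eq_mul_div, div_le_iff₀ (by linarith)]
  rcases le_total (e : ℝ) M with h | h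
  · nlinarith
  · nlinarith [mul_le_mul_of_nonneg_right hab (sub_nonneg.2 h)]
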